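/- The energy of the soliton profile is E_NLS(φ_NLS) = ∫_ℝ [ (A2/8)(φ_NLS'(x))² + (3/8)B φ_NLS(x)⁴ ] dx = −(3α³/(4A2))B². -/

import Mathlib

/-- The NLS soliton profile `φ_NLS(x) = α(−3B/A₂)^{1/2} sech(−(3αB/A₂)x)`,
where `sech t = 1/cosh t`. -/
noncomputable def phiNLS (A2 B α : ℝ) (x : ℝ) : ℝ :=
  α * Real.sqrt (-3 * B / A2) * (1 / Real.cosh (-(3 * α * B / A2) * x))

open Filter Topology MeasureTheory

theorem Real.hasDerivAt_tanh (x : ℝ) : HasDerivAt Real.tanh ((Real.cosh x ^ 2)⁻¹) x := by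
  have h := (Real.hasDerivAt_sinh x).div (Real.hasDerivAt_cosh x) (Real.cosh_pos x).ne'
  have hfun : Real.sinh / Real.cosh = Real.tanh :=
    funext fun y => (Real.tanh_eq_sinh_div_cosh y).symm
  rw [hfun] at h
  convert! h using 1
  rw [inv_eq_one_div, ← Real.cosh_sq_sub_sinh_sq x]
  ring

theorem Real.tendsto_tanh_atTop : Tendsto Real.tanh atTop (𝓝 1) := by
  have he : Tendsto (fun x : ℝ => Real.exp (-x)) atTop (𝓝 0) := Real.tendsto_exp_neg_atTop_nhds_zero
  have h : Tendsto (fun x : ℝ => (1 - Real.exp (-x) ^ 2) / (1 + Real.exp (-x) ^ 2)) atTop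
      (𝓝 ((1 - 0 ^ 2) / (1 + 0 ^ 2))) :=
    ((he.pow 2).const_sub 1).div ((he.pow 2).const_add 1) (by norm_num)
  refine (h.congr fun x => ?_).trans (by norm_num)
  rw [Real.tanh_eq, Real.exp_neg]
  field_simp

theorem Real.tendsto_tanh_atBot : Tendsto Real.tanh atBot (𝓝 (-1)) := by
  refine (Real.tendsto_tanh_atTop.comp tendsto_neg_atBot_atTop).neg.congr fun x => ?_
  simp

theorem Real.integrable_inv_cosh_sq : Integrable fun x : ℝ => (Real.cosh x ^ 2)⁻¹ := by
  refine integrable_inv_one_add_sq.mono'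
    ((Real.continuous_cosh.pow 2).inv₀ fun x =>
      pow_ne_zero 2 (Real.cosh_pos x).ne').aestronglyMeasurable
    (ae_of_all _ fun x => ?_)
  rw [Real.norm_of_nonneg (by positivity), Real.cosh_sq']
  have h : x ^ 2 ≤ Real.sinh x ^ 2 := by
    rcases le_total 0 x with hx | hx
    · exact pow_le_pow_left₀ hx (Real.self_le_sinh_iff.2 hx) 2
    · have := Real.sinh_le_self_iff.2 hx
      nlinarith
  gcongr

/-- `∫ (sech² tanh² - sech⁴) = ∫ (2 tanh² - 1) sech² = -2/3`. -/
theorem Real.integral_two_mul_tanh_sq_sub_one_mul_inv_cosh_sq :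
    ∫ x : ℝ, (2 * Real.tanh x ^ 2 - 1) * (Real.cosh x ^ 2)⁻¹ = -2 / 3 := by
  have hderiv : ∀ x, HasDerivAt (fun y => 2 / 3 * Real.tanh y ^ 3 - Real.tanh y)
      ((2 * Real.tanh x ^ 2 - 1) * (Real.cosh x ^ 2)⁻¹) x := fun x => by
    convert! (((Real.hasDerivAt_tanh x).pow 3).const_mul (2 / 3)).sub
      (Real.hasDerivAt_tanh x) using 1
    norm_num
    ring
  have hcont : Continuous Real.tanh :=
    continuous_iff_continuousAt.2 fun x => (Real.hasDerivAt_tanh x).continuousAt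
  have hint : Integrable fun x : ℝ => (2 * Real.tanh x ^ 2 - 1) * (Real.cosh x ^ 2)⁻¹ := by
    refine Real.integrable_inv_cosh_sq.bdd_mul (c := 1) (by fun_prop) (ae_of_all _ fun x => ?_)
    have h1 : Real.tanh x ^ 2 ≤ 1 := by
      rw [Real.tanh_eq_sinh_div_cosh, div_pow, div_le_one (by positivity), Real.cosh_sq]
      linarith
    rw [Real.norm_eq_abs, abs_le]
    constructor <;> nlinarith [sq_nonneg (Real.tanh x)]
  rw [integral_of_hasDerivAt_of_tendsto hderiv hint
    (((Real.tendsto_tanh_atBot.pow 3).const_mul _).sub Real.tendsto_tanh_atBot)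
    (((Real.tendsto_tanh_atTop.pow 3).const_mul _).sub Real.tendsto_tanh_atTop)]
  norm_num

theorem hasDerivAt_phiNLS (A2 B α x : ℝ) :
    HasDerivAt (phiNLS A2 B α)
      (α * Real.sqrt (-3 * B / A2) * (3 * α * B / A2) *
        (Real.tanh (-(3 * α * B / A2) * x) / Real.cosh (-(3 * α * B / A2) * x))) x := by
  have hlin : HasDerivAt (fun y : ℝ => -(3 * α * B / A2) * y) (-(3 * α * B / A2)) x := by
    simpa using (hasDerivAt_id x).const_mul (-(3 * α * B / A2))
  have hpos := Real.cosh_pos (-(3 * α * B / A2) * x)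
  have h := ((hlin.cosh.inv hpos.ne').const_mul (α * Real.sqrt (-3 * B / A2)))
  convert! h using 1
  · funext y
    simp [phiNLS]
  · rw [Real.tanh_eq_sinh_div_cosh, div_div, ← sq]
    ring

/-- The NLS energy density of the soliton in the rescaled variable. -/
theorem phiNLS_energy_density {A2 B α : ℝ} (hA2 : 0 < A2) (hB : B < 0) (x : ℝ) :
    (A2 / 8) * (deriv (phiNLS A2 B α) x) ^ 2 + (3 / 8) * B * (phiNLS A2 B α x) ^ 4
      = -(27 * α ^ 4 * B ^ 3 / (8 * A2 ^ 2)) *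
        ((2 * Real.tanh (-(3 * α * B / A2) * x) ^ 2 - 1) *
          (Real.cosh (-(3 * α * B / A2) * x) ^ 2)⁻¹) := by
  have hsq : Real.sqrt (-3 * B / A2) ^ 2 = -3 * B / A2 :=
    Real.sq_sqrt (div_nonneg (by linarith) hA2.le)
  rw [(hasDerivAt_phiNLS A2 B α x).deriv, phiNLS]
  generalize -(3 * α * B / A2) * x = t
  have hcosh := Real.cosh_pos t
  have hsech : (Real.cosh t ^ 2)⁻¹ = 1 - Real.tanh t ^ 2 := by
    rw [Real.tanh_eq_sinh_div_cosh]
    field_simp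
    rw [Real.cosh_sq]
    ring
  calc
    _ = A2 / 8 * (α ^ 2 * Real.sqrt (-3 * B / A2) ^ 2 * (3 * α * B / A2) ^ 2 *
          (Real.tanh t ^ 2 * (Real.cosh t ^ 2)⁻¹)) +
        3 / 8 * B * (α ^ 4 * (Real.sqrt (-3 * B / A2) ^ 2) ^ 2 * ((Real.cosh t ^ 2)⁻¹) ^ 2) := by
      ring
    _ = _ := by
      rw [hsq, hsech]
      field_simp
      ring

/-- With `B = A₃/2 + A₄ < 0`, `A₂ > 0`, `α > 0`, the NLS energy of the
soliton profile is `E_NLS(φ_NLS) = ∫_ℝ [(A₂/8)(φ_NLS')² + (3/8)B φ_NLS⁴] dx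
= −(3α³/(4A₂))B²`. -/
theorem phiNLS_energy (A2 A3 A4 α : ℝ) (hA2 : 0 < A2) (hα : 0 < α)
    (hB : A3 / 2 + A4 < 0) :
    ∫ x : ℝ, ((A2 / 8) * (deriv (phiNLS A2 (A3 / 2 + A4) α) x) ^ 2
        + (3 / 8) * (A3 / 2 + A4) * (phiNLS A2 (A3 / 2 + A4) α x) ^ 4)
      = -(3 * α ^ 3 / (4 * A2)) * (A3 / 2 + A4) ^ 2 := by
  have hk : 0 < -(3 * α * (A3 / 2 + A4) / A2) := by
    rw [← neg_div]
    exact div_pos (by nlinarith [mul_pos hα (neg_pos.2 hB)]) hA2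
  simp_rw [phiNLS_energy_density hA2 hB]
  rw [integral_const_mul, Measure.integral_comp_mul_left
    (fun t : ℝ => (2 * Real.tanh t ^ 2 - 1) * (Real.cosh t ^ 2)⁻¹),
    Real.integral_two_mul_tanh_sq_sub_one_mul_inv_cosh_sq, abs_of_pos (inv_pos.2 hk), smul_eq_mul]
  generalize A3 / 2 + A4 = B at hB hk ⊢
  have hB' := hB.ne
  field_simp
  norm_num
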